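/- Let m = m₁ + m₂ and let A and B be m×m real matrices in block upper-triangular form A = fromBlocks A₁₁ A₁₂ 0 A₂₂ and B = fromBlocks B₁₁ B₁₂ 0 B₂₂ (with A₁₁, B₁₁ of order m₁ and A₂₂, B₂₂ of order m₂), and let β = (β₁, β₂) be a row vector of size m with β₁ = 0. Then for every n ≥ 0, β · Pₙ(A,B) · 𝟙ₘ = β₂ · Pₙ(A₂₂,B₂₂) · 𝟙_{m₂}, where 𝟙 denotes the all-ones column vector. In particular, the representation (β, A, B) of order m and the representation (β₂, A₂₂, B₂₂) of order m₂ < m define the same sequence pₙ = β Pₙ(A,B) 𝟙. -/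

import Mathlib

open Matrix

/-- `Pmat A B n = ∏_{i=1}^{n} (A + (1/i) B)` (ordered product, `i = 1` leftmost),
defined by `P₀ = I`, `Pₙ = Pₙ₋₁ (A + (1/n) B)`. -/
noncomputable def Pmat {n : Type*} [Fintype n] [DecidableEq n]
    (A B : Matrix n n ℝ) : ℕ → Matrix n n ℝ
  | 0 => 1
  | k + 1 => Pmat A B k * (A + ((k + 1 : ℕ) : ℝ)⁻¹ • B)

/-- Row vectors supported on the second block stay so under the products `Pmat` of block
upper-triangular matrices, which act on them through their lower right blocks. -/
theorem sumElim_zero_vecMul_Pmat_fromBlocks {m n : Type*} [Fintype m] [Fintype n]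
    [DecidableEq m] [DecidableEq n]
    (A₁₁ : Matrix m m ℝ) (A₁₂ : Matrix m n ℝ) (A₂₂ : Matrix n n ℝ)
    (B₁₁ : Matrix m m ℝ) (B₁₂ : Matrix m n ℝ) (B₂₂ : Matrix n n ℝ) (v : n → ℝ) (k : ℕ) :
    Sum.elim (0 : m → ℝ) v ᵥ* Pmat (fromBlocks A₁₁ A₁₂ 0 A₂₂) (fromBlocks B₁₁ B₁₂ 0 B₂₂) k
      = Sum.elim (0 : m → ℝ) (v ᵥ* Pmat A₂₂ B₂₂ k) := by
  induction k with
  | zero => simp [Pmat]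
  | succ k ih =>
    rw [Pmat, Pmat, ← vecMul_vecMul, ih, fromBlocks_smul, fromBlocks_add, vecMul_fromBlocks,
      ← vecMul_vecMul]
    simp

/-- If the representation `(β, A, B)` has `β₁ = 0` and `A`, `B` are block
upper-triangular, then it defines the same sequence `pₙ = β Pₙ 𝟙` as the smaller
representation `(β₂, A₂₂, B₂₂)`. -/
theorem useless_nodes_reduction {m₁ m₂ : ℕ}
    (A₁₁ : Matrix (Fin m₁) (Fin m₁) ℝ) (A₁₂ : Matrix (Fin m₁) (Fin m₂) ℝ)
    (A₂₂ : Matrix (Fin m₂) (Fin m₂) ℝ)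
    (B₁₁ : Matrix (Fin m₁) (Fin m₁) ℝ) (B₁₂ : Matrix (Fin m₁) (Fin m₂) ℝ)
    (B₂₂ : Matrix (Fin m₂) (Fin m₂) ℝ)
    (β₂ : Fin m₂ → ℝ) :
    ∀ n : ℕ,
      (Sum.elim (0 : Fin m₁ → ℝ) β₂) ⬝ᵥ
        (Pmat (fromBlocks A₁₁ A₁₂ 0 A₂₂) (fromBlocks B₁₁ B₁₂ 0 B₂₂) n *ᵥ
          (fun _ => (1 : ℝ)))
      = β₂ ⬝ᵥ (Pmat A₂₂ B₂₂ n *ᵥ (fun _ => (1 : ℝ))) := by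
  intro n
  rw [dotProduct_mulVec, sumElim_zero_vecMul_Pmat_fromBlocks, dotProduct_mulVec]
  simp [dotProduct]
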